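/- arXiv:2202.13691 — 2 statements merged into one kernel-verified Lean document; each statement's English description precedes it below -/
import Mathlib

section
/- Under the stated setup (quadrature exactness degree n+k with 0 < k ≤ n) and assuming the Marcinkiewicz–Zygmund property with constant η ∈ (0,1), for every f ∈ C([−1,1]) one has ⟨f, (L_n − L_k)f⟩_m ≤ (1/(1−η)) ⟨f, f⟩_m − (1/(1−η)) ⟨L_k f, L_k f⟩_m, where (L_n − L_k)f = ∑_{ℓ=k+1}^{n} ⟨f, p_ℓ⟩_m p_ℓ. -/
open MeasureTheory

/-- The discrete inner product `⟨v,z⟩_m = ∑_j w_j v(x_j) z(x_j)` of an m-point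
quadrature rule with points `x` and weights `w`. -/
noncomputable def discInner {m : ℕ} (w x : Fin m → ℝ) (v z : ℝ → ℝ) : ℝ :=
  ∑ j, w j * v (x j) * z (x j)

/-- The hyperinterpolant of degree `t`:  `L_t f = ∑_{ℓ=0}^{t} ⟨f, p_ℓ⟩_m p_ℓ`. -/
noncomputable def hyper {m : ℕ} (w x : Fin m → ℝ) (p : ℕ → Polynomial ℝ)
    (t : ℕ) (f : ℝ → ℝ) : Polynomial ℝ :=
  ∑ ℓ ∈ Finset.range (t + 1),
    Polynomial.C (discInner w x f (fun y => (p ℓ).eval y)) * p ℓ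

/-- The "tail" operator `(L_n − L_k) f = ∑_{ℓ=k+1}^{n} ⟨f, p_ℓ⟩_m p_ℓ`. -/
noncomputable def hyperDiff {m : ℕ} (w x : Fin m → ℝ) (p : ℕ → Polynomial ℝ)
    (k n : ℕ) (f : ℝ → ℝ) : Polynomial ℝ :=
  ∑ ℓ ∈ Finset.Ioc k n,
    Polynomial.C (discInner w x f (fun y => (p ℓ).eval y)) * p ℓ

/-- Parseval's identity for the partial sums of an expansion in polynomials that are
orthonormal on `[-1,1]`. -/
theorem integral_eval_sum_mul_eval_sum {n : ℕ} {p : ℕ → Polynomial ℝ}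
    (horth : ∀ ℓ ℓ', ℓ ≤ n → ℓ' ≤ n →
      (∫ y in (-1 : ℝ)..1, (p ℓ).eval y * (p ℓ').eval y) = if ℓ = ℓ' then 1 else 0)
    (a : ℕ → ℝ) {s t : Finset ℕ} (hs : ∀ ℓ ∈ s, ℓ ≤ n) (ht : ∀ ℓ ∈ t, ℓ ≤ n) :
    ∫ y in (-1 : ℝ)..1, (∑ ℓ ∈ s, Polynomial.C (a ℓ) * p ℓ).eval y *
      (∑ ℓ ∈ t, Polynomial.C (a ℓ) * p ℓ).eval y = ∑ ℓ ∈ s ∩ t, a ℓ ^ 2 := by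
  have hint : ∀ (c : ℝ) (q r : Polynomial ℝ), IntervalIntegrable
      (fun y => c * (q.eval y * r.eval y)) volume (-1) 1 := fun c q r =>
    (continuous_const.mul (q.continuous.mul r.continuous)).intervalIntegrable _ _
  calc
    _ = ∫ y in (-1 : ℝ)..1, ∑ i ∈ s, ∑ j ∈ t,
        a i * a j * ((p i).eval y * (p j).eval y) := by
      congr 1 with y
      simp only [Polynomial.eval_finsetSum, Polynomial.eval_mul, Polynomial.eval_C,
        Finset.sum_mul_sum]
      exact Finset.sum_congr rfl fun i _ => Finset.sum_congr rfl fun j _ => by ring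
    _ = ∑ i ∈ s, ∑ j ∈ t, a i * a j * if i = j then 1 else 0 := by
      rw [intervalIntegral.integral_finsetSum fun i _ =>
        Continuous.intervalIntegrable (by fun_prop) _ _]
      refine Finset.sum_congr rfl fun i hi => ?_
      rw [intervalIntegral.integral_finsetSum fun j _ => hint _ _ _]
      refine Finset.sum_congr rfl fun j hj => ?_
      rw [intervalIntegral.integral_const_mul, horth i j (hs i hi) (ht j hj)]
    _ = ∑ ℓ ∈ s ∩ t, a ℓ ^ 2 := by
      simp [Finset.sum_ite_mem, ← pow_two]

/-- Pairing `f` with a partial sum of its discrete expansion gives the sum of the squared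
coefficients. -/
theorem discInner_eval_sum {m : ℕ} (w x : Fin m → ℝ) (p : ℕ → Polynomial ℝ) (f : ℝ → ℝ)
    (s : Finset ℕ) :
    discInner w x f (fun y => (∑ ℓ ∈ s,
      Polynomial.C (discInner w x f (fun y => (p ℓ).eval y)) * p ℓ).eval y) =
      ∑ ℓ ∈ s, discInner w x f (fun y => (p ℓ).eval y) ^ 2 := by
  calc
    _ = ∑ j, ∑ ℓ ∈ s, discInner w x f (fun y => (p ℓ).eval y) *
        (w j * f (x j) * (p ℓ).eval (x j)) := by
      rw [discInner]
      simp only [Polynomial.eval_finsetSum, Polynomial.eval_mul, Polynomial.eval_C,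
        Finset.mul_sum]
      exact Finset.sum_congr rfl fun i _ => Finset.sum_congr rfl fun j _ => by ring
    _ = _ := by
      rw [Finset.sum_comm]
      refine Finset.sum_congr rfl fun ℓ _ => ?_
      rw [← Finset.mul_sum, pow_two]
      rfl

/-- Nonnegativity of the discrete square of `f - u - c v`, expanded. -/
theorem discInner_sub_sub_nonneg {m : ℕ} {w : Fin m → ℝ} (hw : ∀ j, 0 < w j)
    (x : Fin m → ℝ) (f u v : ℝ → ℝ) (c : ℝ) :
    0 ≤ discInner w x f f + discInner w x u u + c ^ 2 * discInner w x v v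
      - 2 * discInner w x f u - 2 * c * discInner w x f v + 2 * c * discInner w x u v := by
  have h : 0 ≤ ∑ j, w j * (f (x j) - u (x j) - c * v (x j)) ^ 2 :=
    Finset.sum_nonneg fun j _ => mul_nonneg (hw j).le (sq_nonneg _)
  refine h.trans_eq ?_
  simp only [discInner, Finset.mul_sum, ← Finset.sum_add_distrib, ← Finset.sum_sub_distrib]
  exact Finset.sum_congr rfl fun j _ => by ring

/-- A combination of the `p ℓ` with `ℓ ≤ d` has degree at most `d`. -/
theorem natDegree_sum_C_mul_le {p : ℕ → Polynomial ℝ} {d : ℕ} (a : ℕ → ℝ) {s : Finset ℕ}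
    (hs : ∀ ℓ ∈ s, (p ℓ).natDegree ≤ d) :
    (∑ ℓ ∈ s, Polynomial.C (a ℓ) * p ℓ).natDegree ≤ d :=
  Polynomial.natDegree_sum_le_of_forall_le _ _ fun ℓ hℓ =>
    (Polynomial.natDegree_C_mul_le _ _).trans (hs ℓ hℓ)

/-- `⟨f,(L_n−L_k)f⟩_m ≤ (1/(1−η))⟨f,f⟩_m − (1/(1−η))⟨L_k f, L_k f⟩_m`. -/
theorem tail_inner_bound
    (n k m : ℕ) (hn : 1 ≤ n) (hk0 : 0 < k) (hkn : k ≤ n)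
    (x w : Fin m → ℝ)
    (hx : ∀ j, x j ∈ Set.Icc (-1 : ℝ) 1)
    (hw : ∀ j, 0 < w j)
    (hex : ∀ g : Polynomial ℝ, g.natDegree ≤ n + k →
      ∑ j, w j * g.eval (x j) = ∫ y in (-1 : ℝ)..1, g.eval y)
    (p : ℕ → Polynomial ℝ)
    (hdeg : ∀ ℓ, ℓ ≤ n → (p ℓ).natDegree = ℓ)
    (horth : ∀ ℓ ℓ', ℓ ≤ n → ℓ' ≤ n →
      (∫ y in (-1 : ℝ)..1, (p ℓ).eval y * (p ℓ').eval y) = if ℓ = ℓ' then 1 else 0)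
    (η : ℝ) (hη : η ∈ Set.Ioo (0 : ℝ) 1)
    (hMZ : ∀ χ : Polynomial ℝ, χ.natDegree ≤ n →
      |(∑ j, w j * (χ.eval (x j)) ^ 2) - ∫ y in (-1 : ℝ)..1, (χ.eval y) ^ 2| ≤
        η * ∫ y in (-1 : ℝ)..1, (χ.eval y) ^ 2)
    (f : ℝ → ℝ) (hf : ContinuousOn f (Set.Icc (-1 : ℝ) 1))
    :
    discInner w x f (fun y => (hyperDiff w x p k n f).eval y) ≤
      (1 / (1 - η)) * discInner w x f f -
        (1 / (1 - η)) * discInner w x (fun y => (hyper w x p k f).eval y) (fun y => (hyper w x p k f).eval y) := by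
  obtain ⟨hη0, hη1⟩ := hη
  set a : ℕ → ℝ := fun ℓ => discInner w x f (fun y => (p ℓ).eval y)
  set L := hyper w x p k f
  set D := hyperDiff w x p k n f
  have hLe : L = ∑ ℓ ∈ Finset.range (k + 1), Polynomial.C (a ℓ) * p ℓ := rfl
  have hDe : D = ∑ ℓ ∈ Finset.Ioc k n, Polynomial.C (a ℓ) * p ℓ := rfl
  have hr : ∀ ℓ ∈ Finset.range (k + 1), ℓ ≤ k := fun ℓ hℓ => by
    simpa [Nat.lt_succ_iff] using hℓ
  have ht : ∀ ℓ ∈ Finset.Ioc k n, ℓ ≤ n := fun ℓ hℓ => (Finset.mem_Ioc.1 hℓ).2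
  have hrn : ∀ ℓ ∈ Finset.range (k + 1), ℓ ≤ n := fun ℓ hℓ => (hr ℓ hℓ).trans hkn
  have hLdeg : L.natDegree ≤ k := natDegree_sum_C_mul_le a fun ℓ hℓ =>
    (hdeg ℓ (hrn ℓ hℓ)).trans_le (hr ℓ hℓ)
  have hDdeg : D.natDegree ≤ n := natDegree_sum_C_mul_le a fun ℓ hℓ =>
    (hdeg ℓ (ht ℓ hℓ)).trans_le (ht ℓ hℓ)
  have hexact : ∀ q : Polynomial ℝ, q.natDegree ≤ n →
      discInner w x (fun y => L.eval y) (fun y => q.eval y) =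
        ∫ y in (-1 : ℝ)..1, L.eval y * q.eval y := fun q hq => by
    have h := hex (L * q) (Polynomial.natDegree_mul_le.trans (by omega))
    simpa only [discInner, Polynomial.eval_mul, mul_assoc] using h
  have hfL : discInner w x f (fun y => L.eval y) = ∑ ℓ ∈ Finset.range (k + 1), a ℓ ^ 2 :=
    discInner_eval_sum w x p f _
  have hfD : discInner w x f (fun y => D.eval y) = ∑ ℓ ∈ Finset.Ioc k n, a ℓ ^ 2 :=
    discInner_eval_sum w x p f _
  have hLL : discInner w x (fun y => L.eval y) (fun y => L.eval y) =
      ∑ ℓ ∈ Finset.range (k + 1), a ℓ ^ 2 := by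
    rw [hexact L (hLdeg.trans hkn), hLe, integral_eval_sum_mul_eval_sum horth a hrn hrn,
      Finset.inter_self]
  have hLD : discInner w x (fun y => L.eval y) (fun y => D.eval y) = 0 := by
    have hdisj : Finset.range (k + 1) ∩ Finset.Ioc k n = ∅ := by
      ext ℓ
      simp only [Finset.mem_inter, Finset.mem_range, Finset.mem_Ioc, Finset.notMem_empty, iff_false]
      omega
    rw [hexact D hDdeg, hLe, hDe, integral_eval_sum_mul_eval_sum horth a hrn ht, hdisj,
      Finset.sum_empty]
  have hDD : discInner w x (fun y => D.eval y) (fun y => D.eval y) ≤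
      (1 + η) * ∑ ℓ ∈ Finset.Ioc k n, a ℓ ^ 2 := by
    have hint : ∫ y in (-1 : ℝ)..1, D.eval y ^ 2 = ∑ ℓ ∈ Finset.Ioc k n, a ℓ ^ 2 := by
      simp only [pow_two (Polynomial.eval _ D)]
      rw [hDe, integral_eval_sum_mul_eval_sum horth a ht ht, Finset.inter_self]
    have h := (abs_le.1 (hMZ D hDdeg)).2
    rw [hint] at h
    simp only [discInner, mul_assoc, ← pow_two]
    linarith
  have hpos : 0 ≤ ∑ ℓ ∈ Finset.Ioc k n, a ℓ ^ 2 := Finset.sum_nonneg fun _ _ => sq_nonneg _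
  have key := discInner_sub_sub_nonneg hw x f (fun y => L.eval y) (fun y => D.eval y) (1 - η)
  rw [hfL, hfD, hLL, hLD] at key
  rw [hfD, hLL, ← mul_sub, one_div, inv_mul_eq_div, le_div_iff₀ (sub_pos.2 hη1)]
  have h₁ := mul_le_mul_of_nonneg_left hDD (sq_nonneg (1 - η))
  have h₂ := mul_nonneg (mul_nonneg (sub_pos.2 hη1).le (sq_nonneg η)) hpos
  linear_combination key + h₁ + h₂
end

section
/- Convergence of hyperinterpolation with relaxed exactness: suppose that for each n ≥ 1 one is given an integer k_n with 0 < k_n ≤ n such that k_n → ∞ as n → ∞, an m_n-point quadrature rule on [−1,1] with positive weights having exactness degree n + k_n and the Marcinkiewicz–Zygmund property with a constant η ∈ (0,1) independent of n, and an orthonormal graded basis p₀,…,p_n (deg p_ℓ = ℓ, orthonormal in L²([−1,1])). Then for every f ∈ C([−1,1]) the hyperinterpolants satisfy ‖L_n f − f‖₂ → 0 as n → ∞. -/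
open MeasureTheory

/-- The hyperinterpolant is additive in the function. -/
theorem hyper_add {m : ℕ} (w x : Fin m → ℝ) (p : ℕ → Polynomial ℝ) (t : ℕ) (f g : ℝ → ℝ) :
    hyper w x p t (fun y => f y + g y) = hyper w x p t f + hyper w x p t g := by
  simp only [hyper, ← Finset.sum_add_distrib, ← add_mul, ← Polynomial.C_add]
  refine Finset.sum_congr rfl fun ℓ _ => ?_
  congr 2
  simp only [discInner, ← Finset.sum_add_distrib]
  exact Finset.sum_congr rfl fun j _ => by ring

/-- The hyperinterpolant is homogeneous in the function. -/
theorem hyper_const_mul {m : ℕ} (w x : Fin m → ℝ) (p : ℕ → Polynomial ℝ) (t : ℕ) (a : ℝ)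
    (f : ℝ → ℝ) :
    hyper w x p t (fun y => a * f y) = Polynomial.C a * hyper w x p t f := by
  simp only [hyper, Finset.mul_sum, ← mul_assoc, ← Polynomial.C_mul]
  refine Finset.sum_congr rfl fun ℓ _ => ?_
  congr 2
  simp only [discInner, Finset.mul_sum]
  exact Finset.sum_congr rfl fun j _ => by ring

/-- The hyperinterpolant of degree `t` is a polynomial of degree at most `t`. -/
theorem natDegree_hyper_le {m : ℕ} (w x : Fin m → ℝ) {p : ℕ → Polynomial ℝ}
    (hdeg : ∀ ℓ, (p ℓ).natDegree = ℓ) (t : ℕ) (f : ℝ → ℝ) :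
    (hyper w x p t f).natDegree ≤ t := by
  refine Polynomial.natDegree_sum_le_of_forall_le _ _ fun ℓ hℓ => ?_
  refine (Polynomial.natDegree_C_mul_le _ _).trans ?_
  rw [hdeg]
  exact Nat.lt_succ_iff.mp (Finset.mem_range.mp hℓ)

/-- Hyperinterpolation reproduces a basis polynomial `p i` as soon as the rule is exact
in degree `t + i`. -/
theorem hyper_basis {m : ℕ} {w x : Fin m → ℝ} {p : ℕ → Polynomial ℝ}
    (hdeg : ∀ ℓ, (p ℓ).natDegree = ℓ)
    (horth : ∀ ℓ ℓ',
      (∫ y in (-1 : ℝ)..1, (p ℓ).eval y * (p ℓ').eval y) = if ℓ = ℓ' then 1 else 0)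
    {t i : ℕ} (hi : i ≤ t)
    (hex : ∀ g : Polynomial ℝ, g.natDegree ≤ t + i →
      ∑ j, w j * g.eval (x j) = ∫ y in (-1 : ℝ)..1, g.eval y) :
    hyper w x p t (fun y => (p i).eval y) = p i := by
  have hcoeff : ∀ ℓ ∈ Finset.range (t + 1),
      Polynomial.C (discInner w x (fun y => (p i).eval y) (fun y => (p ℓ).eval y)) * p ℓ =
        if i = ℓ then p ℓ else 0 := by
    intro ℓ hℓ
    have hℓt : ℓ ≤ t := Nat.lt_succ_iff.mp (Finset.mem_range.mp hℓ)
    have h := hex (p i * p ℓ) (by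
      refine Polynomial.natDegree_mul_le.trans ?_
      rw [hdeg, hdeg]
      lia)
    simp only [Polynomial.eval_mul, horth, ← mul_assoc] at h
    rw [discInner, h]
    split_ifs <;> simp
  rw [hyper, Finset.sum_congr rfl hcoeff, Finset.sum_ite_eq,
    if_pos (Finset.mem_range.mpr (Nat.lt_succ_of_le hi))]

/-- Parseval-type identity: `‖L_t f‖₂² = ⟨f, L_t f⟩_m`. -/
theorem integral_hyper_sq {m : ℕ} (w x : Fin m → ℝ) {p : ℕ → Polynomial ℝ}
    (horth : ∀ ℓ ℓ',
      (∫ y in (-1 : ℝ)..1, (p ℓ).eval y * (p ℓ').eval y) = if ℓ = ℓ' then 1 else 0)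
    (t : ℕ) (f : ℝ → ℝ) :
    ∫ y in (-1 : ℝ)..1, ((hyper w x p t f).eval y) ^ 2 =
      discInner w x f (fun y => (hyper w x p t f).eval y) := by
  set c : ℕ → ℝ := fun ℓ => discInner w x f (fun y => (p ℓ).eval y) with hc
  have heval : ∀ y, (hyper w x p t f).eval y =
      ∑ ℓ ∈ Finset.range (t + 1), c ℓ * (p ℓ).eval y := fun y => by
    simp [hyper, Polynomial.eval_finsetSum, hc]
  have hleft : ∫ y in (-1 : ℝ)..1, ((hyper w x p t f).eval y) ^ 2 =
      ∑ ℓ ∈ Finset.range (t + 1), c ℓ * c ℓ := by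
    have hsq : ∀ y, ((hyper w x p t f).eval y) ^ 2 = ∑ i ∈ Finset.range (t + 1),
        ∑ j ∈ Finset.range (t + 1), c i * c j * ((p i).eval y * (p j).eval y) := fun y => by
      simp only [heval, sq, Finset.sum_mul_sum, mul_mul_mul_comm (c _)]
    simp only [hsq]
    rw [intervalIntegral.integral_finsetSum
      fun i _ => Continuous.intervalIntegrable (by fun_prop) _ _]
    refine Finset.sum_congr rfl fun i hi => ?_
    rw [intervalIntegral.integral_finsetSum
      fun j _ => Continuous.intervalIntegrable (by fun_prop) _ _]
    simp only [intervalIntegral.integral_const_mul, horth, mul_ite, mul_one,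
      mul_zero, Finset.sum_ite_eq, if_pos hi]
  have hright : discInner w x f (fun y => (hyper w x p t f).eval y) =
      ∑ ℓ ∈ Finset.range (t + 1), c ℓ * c ℓ := by
    simp only [discInner, heval, Finset.mul_sum]
    rw [Finset.sum_comm]
    refine Finset.sum_congr rfl fun ℓ _ => ?_
    have hcℓ : c ℓ = ∑ j, w j * f (x j) * (p ℓ).eval (x j) := rfl
    conv_rhs => enter [2]; rw [hcℓ]
    rw [Finset.mul_sum]
    exact Finset.sum_congr rfl fun j _ => by ring
  rw [hleft, hright]

/-- Stability: if `|g| ≤ ε` on the nodes then `‖L_t g‖₂² ≤ 4 ε²`. -/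
theorem integral_hyper_sq_le {m : ℕ} {w x : Fin m → ℝ} {p : ℕ → Polynomial ℝ}
    (hdeg : ∀ ℓ, (p ℓ).natDegree = ℓ)
    (horth : ∀ ℓ ℓ',
      (∫ y in (-1 : ℝ)..1, (p ℓ).eval y * (p ℓ').eval y) = if ℓ = ℓ' then 1 else 0)
    (hw : ∀ j, 0 < w j) (hsum : ∑ j, w j = 2) {η : ℝ} (hη : η < 1) {t : ℕ}
    (hMZ : ∀ χ : Polynomial ℝ, χ.natDegree ≤ t →
      |(∑ j, w j * (χ.eval (x j)) ^ 2) - ∫ y in (-1 : ℝ)..1, (χ.eval y) ^ 2| ≤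
        η * ∫ y in (-1 : ℝ)..1, (χ.eval y) ^ 2)
    {g : ℝ → ℝ} {ε : ℝ} (hg : ∀ j, |g (x j)| ≤ ε) :
    ∫ y in (-1 : ℝ)..1, ((hyper w x p t g).eval y) ^ 2 ≤ 4 * ε ^ 2 := by
  set χ := hyper w x p t g
  have hparseval : ∫ y in (-1 : ℝ)..1, (χ.eval y) ^ 2 = discInner w x g (fun y => χ.eval y) :=
    integral_hyper_sq w x horth t g
  have hdisc := (abs_le.mp (hMZ χ (natDegree_hyper_le w x hdeg t g))).2
  have hnonneg : 0 ≤ ∫ y in (-1 : ℝ)..1, (χ.eval y) ^ 2 :=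
    intervalIntegral.integral_nonneg (by norm_num) fun y _ => sq_nonneg _
  have hyoung : discInner w x g (fun y => χ.eval y) ≤
      ε ^ 2 * ∑ j, w j + (1 / 4) * ∑ j, w j * (χ.eval (x j)) ^ 2 := by
    rw [discInner, Finset.mul_sum, Finset.mul_sum, ← Finset.sum_add_distrib]
    refine Finset.sum_le_sum fun j _ => ?_
    have hsq : g (x j) ^ 2 ≤ ε ^ 2 := sq_le_sq' (abs_le.mp (hg j)).1 (abs_le.mp (hg j)).2
    have hpoint : g (x j) * χ.eval (x j) ≤ ε ^ 2 + 1 / 4 * χ.eval (x j) ^ 2 := by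
      nlinarith [sq_nonneg (g (x j) - χ.eval (x j) / 2)]
    nlinarith [mul_le_mul_of_nonneg_left hpoint (hw j).le]
  rw [hsum, ← hparseval] at hyoung
  nlinarith

/-- A sequence of polynomials with `deg p_ℓ = ℓ`, orthonormal on `[-1,1]`, spans all
polynomials. -/
theorem span_range_orthonormal_eq_top {p : ℕ → Polynomial ℝ}
    (hdeg : ∀ ℓ, (p ℓ).natDegree = ℓ)
    (horth : ∀ ℓ ℓ',
      (∫ y in (-1 : ℝ)..1, (p ℓ).eval y * (p ℓ').eval y) = if ℓ = ℓ' then 1 else 0) :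
    Submodule.span ℝ (Set.range p) = ⊤ := by
  have hne : ∀ ℓ, p ℓ ≠ 0 := fun ℓ h => by simpa [h] using horth ℓ ℓ
  let S : Polynomial.Sequence ℝ :=
    ⟨p, fun ℓ => by rw [Polynomial.degree_eq_natDegree (hne ℓ), hdeg]⟩
  exact S.span fun ℓ => (Polynomial.leadingCoeff_ne_zero.mpr (hne ℓ)).isUnit

/-- Weierstrass approximation on `[-1,1]`. -/
theorem exists_polynomial_abs_sub_le {f : ℝ → ℝ} (hf : ContinuousOn f (Set.Icc (-1 : ℝ) 1))
    {ε : ℝ} (hε : 0 < ε) :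
    ∃ q : Polynomial ℝ, ∀ y ∈ Set.Icc (-1 : ℝ) 1, |f y - q.eval y| ≤ ε := by
  obtain ⟨q, hq⟩ := exists_polynomial_near_of_continuousOn (-1) 1 f hf ε hε
  exact ⟨q, fun y hy => by rw [abs_sub_comm]; exact (hq y hy).le⟩

/-- convergence of hyperinterpolation with relaxed exactness: if for
every `n ≥ 1` one has an `m n`-point positive-weight rule on `[-1,1]` of exactness
degree `n + k n` (with `0 < k n ≤ n`, `k n → ∞`) and a Marcinkiewicz–Zygmund constant
`η ∈ (0,1)` independent of `n`, then `‖L_n f − f‖₂ → 0` for every `f ∈ C([-1,1])`. -/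
theorem hyper_convergence
    (k : ℕ → ℕ) (hk : ∀ n, 1 ≤ n → 0 < k n ∧ k n ≤ n)
    (hktend : Filter.Tendsto k Filter.atTop Filter.atTop)
    (m : ℕ → ℕ) (x : (n : ℕ) → Fin (m n) → ℝ) (w : (n : ℕ) → Fin (m n) → ℝ)
    (hx : ∀ n j, x n j ∈ Set.Icc (-1 : ℝ) 1)
    (hw : ∀ n j, 0 < w n j)
    (hex : ∀ n, 1 ≤ n → ∀ g : Polynomial ℝ, g.natDegree ≤ n + k n →
      ∑ j, w n j * g.eval (x n j) = ∫ y in (-1 : ℝ)..1, g.eval y)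
    (η : ℝ) (hη : η ∈ Set.Ioo (0 : ℝ) 1)
    (hMZ : ∀ n, 1 ≤ n → ∀ χ : Polynomial ℝ, χ.natDegree ≤ n →
      |(∑ j, w n j * (χ.eval (x n j)) ^ 2) - ∫ y in (-1 : ℝ)..1, (χ.eval y) ^ 2| ≤
        η * ∫ y in (-1 : ℝ)..1, (χ.eval y) ^ 2)
    (p : ℕ → Polynomial ℝ)
    (hdeg : ∀ ℓ, (p ℓ).natDegree = ℓ)
    (horth : ∀ ℓ ℓ',
      (∫ y in (-1 : ℝ)..1, (p ℓ).eval y * (p ℓ').eval y) = if ℓ = ℓ' then 1 else 0)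
    (f : ℝ → ℝ) (hf : ContinuousOn f (Set.Icc (-1 : ℝ) 1)) :
    Filter.Tendsto
      (fun n => Real.sqrt (∫ y in (-1 : ℝ)..1, ((hyper (w n) (x n) p n f).eval y - f y) ^ 2))
      Filter.atTop (nhds 0) := by
  have hrepr : ∀ q : Polynomial ℝ, ∀ᶠ n in Filter.atTop,
      hyper (w n) (x n) p n (fun y => q.eval y) = q := by
    intro q
    have hq : q ∈ Submodule.span ℝ (Set.range p) := by
      rw [span_range_orthonormal_eq_top hdeg horth]
      trivial
    induction hq using Submodule.span_induction with
    | mem q hq =>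
      obtain ⟨i, rfl⟩ := hq
      filter_upwards [hktend.eventually_ge_atTop i, Filter.eventually_ge_atTop (max i 1)]
        with n hkn hn
      exact hyper_basis hdeg horth (by lia) fun g hg => hex n (by lia) g (by lia)
    | zero => exact Filter.Eventually.of_forall fun n => by simp [hyper, discInner]
    | add q r _ _ hq hr =>
      filter_upwards [hq, hr] with n hqn hrn
      simp only [Polynomial.eval_add, hyper_add, hqn, hrn]
    | smul a q _ hq =>
      filter_upwards [hq] with n hqn
      simp only [Polynomial.eval_smul, smul_eq_mul, hyper_const_mul, hqn]
      rw [Polynomial.smul_eq_C_mul]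
  have hbound : ∀ ε : ℝ, 0 < ε → ∀ᶠ n in Filter.atTop,
      ∫ y in (-1 : ℝ)..1, ((hyper (w n) (x n) p n f).eval y - f y) ^ 2 ≤ 12 * ε ^ 2 := by
    intro ε hε
    obtain ⟨q, hq⟩ := exists_polynomial_abs_sub_le hf hε
    filter_upwards [hrepr q, Filter.eventually_ge_atTop 1] with n hn hn1
    have hsum : ∑ j, w n j = 2 := by
      have h := hex n hn1 1 (by simp)
      norm_num at h
      exact h
    have hsplit : hyper (w n) (x n) p n f =
        hyper (w n) (x n) p n (fun y => f y - q.eval y) + q := by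
      conv_rhs =>
        enter [2]
        rw [← hn]
      rw [← hyper_add]
      simp
    have hstable := integral_hyper_sq_le hdeg horth (hw n) hsum hη.2 (hMZ n hn1)
      (g := fun y => f y - q.eval y) fun j => hq _ (hx n j)
    rw [hsplit]
    set χ := hyper (w n) (x n) p n (fun y => f y - q.eval y)
    have hcont : ContinuousOn f (Set.uIcc (-1 : ℝ) 1) := by
      rwa [Set.uIcc_of_le (by norm_num)]
    calc ∫ y in (-1 : ℝ)..1, ((χ + q).eval y - f y) ^ 2
        ≤ ∫ y in (-1 : ℝ)..1, (2 * (χ.eval y) ^ 2 + 2 * ε ^ 2) := by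
          refine intervalIntegral.integral_mono_on (by norm_num)
            (ContinuousOn.intervalIntegrable (by fun_prop))
            (Continuous.intervalIntegrable (by fun_prop) _ _) fun y hy => ?_
          have hsq : (f y - q.eval y) ^ 2 ≤ ε ^ 2 :=
            sq_le_sq' (abs_le.mp (hq y hy)).1 (abs_le.mp (hq y hy)).2
          rw [Polynomial.eval_add]
          nlinarith [sq_nonneg (χ.eval y + (f y - q.eval y))]
      _ = 2 * (∫ y in (-1 : ℝ)..1, (χ.eval y) ^ 2) + 4 * ε ^ 2 := by
          rw [intervalIntegral.integral_add
            (Continuous.intervalIntegrable (by fun_prop) _ _)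
            (Continuous.intervalIntegrable (by fun_prop) _ _),
            intervalIntegral.integral_const_mul, intervalIntegral.integral_const, smul_eq_mul]
          ring
      _ ≤ 12 * ε ^ 2 := by linarith
  rw [Metric.tendsto_nhds]
  intro ε hε
  filter_upwards [hbound (ε / 4) (by positivity)] with n hn
  rw [Real.dist_eq, sub_zero, abs_of_nonneg (Real.sqrt_nonneg _), Real.sqrt_lt' hε]
  nlinarith [sq_pos_of_pos hε]
end
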